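/- arXiv:2206.03425 — 14 statements merged into one kernel-verified Lean document; each statement's English description precedes it below -/
import Mathlib

section
/- The primal transfer matrix intertwines the preconditioned operators: T_P * P_BDDC = P_FETI * T_P, where T_P = B_D*S*R. -/
open Matrix

theorem stmt_1 {n m k : ℕ} (hn : 0 < n) (hm : 0 < m) (hk : 0 < k)
    (S : Matrix (Fin n) (Fin n) ℝ) (hS : Sᵀ = S)
    (R : Matrix (Fin n) (Fin m) ℝ) (E : Matrix (Fin m) (Fin n) ℝ)
    (B B_D : Matrix (Fin k) (Fin n) ℝ)
    (hER : E * R = 1) (hBR : B * R = 0) (hBBD : B * B_Dᵀ = 1)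
    (hdec : B_Dᵀ * B + R * E = 1)
    (H : Matrix (Fin n) (Fin n) ℝ) (hH : Hᵀ = H)
    (hHSR : H * S * R = R) (hHSBD : H * S * B_Dᵀ = B_Dᵀ) :
    (B_D * S * R) * ((E * H * Eᵀ) * (Rᵀ * S * R)) =
      ((B_D * S * B_Dᵀ) * (B * H * Bᵀ)) * (B_D * S * R) := by
  have hHS : H * S = 1 := by
    calc H * S = H * S * (B_Dᵀ * B + R * E) := by rw [hdec, Matrix.mul_one]
      _ = B_Dᵀ * B + R * E := by
        rw [Matrix.mul_add, ← Matrix.mul_assoc, ← Matrix.mul_assoc, hHSR, hHSBD]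
      _ = 1 := hdec
  have hSH : S * H = 1 := mul_eq_one_comm.mp hHS
  have hEBD : E * B_Dᵀ = 0 := by
    have h : B_Dᵀ + R * (E * B_Dᵀ) = B_Dᵀ := by
      simpa [Matrix.add_mul, Matrix.mul_assoc, hBBD] using congrArg (· * B_Dᵀ) hdec
    have h' : R * (E * B_Dᵀ) = 0 := by simpa using h
    simpa [← Matrix.mul_assoc, hER] using congrArg (E * ·) h'
  have hBDE : B_D * Eᵀ = 0 := by
    simpa [Matrix.transpose_mul] using congrArg Matrix.transpose hEBD
  have hQ : B_Dᵀ * B = 1 - R * E := eq_sub_of_add_eq hdec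
  have hQT : Bᵀ * B_D = 1 - Eᵀ * Rᵀ := by
    simpa [Matrix.transpose_mul] using congrArg Matrix.transpose hQ
  have hQR : (1 - R * E) * R = 0 := by
    rw [Matrix.sub_mul, Matrix.one_mul, Matrix.mul_assoc, hER, Matrix.mul_one, sub_self]
  symm
  calc ((B_D * S * B_Dᵀ) * (B * H * Bᵀ)) * (B_D * S * R)
      = B_D * S * (B_Dᵀ * B) * H * (Bᵀ * B_D) * S * R := by simp only [Matrix.mul_assoc]
    _ = B_D * S * ((1 - R * E) * (H * S * R))
          - B_D * (S * H) * Eᵀ * Rᵀ * S * R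
          + B_D * S * R * E * H * Eᵀ * Rᵀ * S * R := by
      rw [hQ, hQT]
      simp only [Matrix.mul_sub, Matrix.sub_mul, Matrix.mul_one, Matrix.one_mul,
        Matrix.mul_assoc]
      abel
    _ = (B_D * S * R) * ((E * H * Eᵀ) * (Rᵀ * S * R)) := by
      rw [hHSR, hQR, hSH, Matrix.mul_one, hBDE]
      simp [Matrix.mul_assoc]
end

section
/- The dual transfer matrix intertwines the preconditioned operators: T_D * P_FETI = P_BDDC * T_D, where T_D = E*H*Bᵀ. -/
open Matrix

theorem stmt_2 {n m k : ℕ} (hn : 0 < n) (hm : 0 < m) (hk : 0 < k)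
    (S : Matrix (Fin n) (Fin n) ℝ) (hS : Sᵀ = S)
    (R : Matrix (Fin n) (Fin m) ℝ) (E : Matrix (Fin m) (Fin n) ℝ)
    (B B_D : Matrix (Fin k) (Fin n) ℝ)
    (hER : E * R = 1) (hBR : B * R = 0) (hBBD : B * B_Dᵀ = 1)
    (hdec : B_Dᵀ * B + R * E = 1)
    (H : Matrix (Fin n) (Fin n) ℝ) (hH : Hᵀ = H)
    (hHSR : H * S * R = R) (hHSBD : H * S * B_Dᵀ = B_Dᵀ) :
    (E * H * Bᵀ) * ((B_D * S * B_Dᵀ) * (B * H * Bᵀ)) =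
      ((E * H * Eᵀ) * (Rᵀ * S * R)) * (E * H * Bᵀ) := by
  have hHS : H * S = 1 := by
    calc H * S = H * S * (B_Dᵀ * B + R * E) := by rw [hdec, Matrix.mul_one]
      _ = H * S * B_Dᵀ * B + H * S * R * E := by
        rw [Matrix.mul_add, ← Matrix.mul_assoc, ← Matrix.mul_assoc]
      _ = 1 := by rw [hHSR, hHSBD, hdec]
  have hSH : S * H = 1 := mul_eq_one_comm.mp hHS
  have hQ : B_Dᵀ * B = 1 - R * E := eq_sub_of_add_eq hdec
  have hQt : Bᵀ * B_D = 1 - Eᵀ * Rᵀ := by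
    simpa [Matrix.transpose_mul] using congrArg Matrix.transpose hQ
  have hRB : Rᵀ * Bᵀ = 0 := by
    rw [← Matrix.transpose_mul, hBR, Matrix.transpose_zero]
  have hleft : E * H * (Eᵀ * Rᵀ) * (S * H) * Bᵀ = 0 := by
    simp only [hSH, Matrix.mul_one, Matrix.mul_assoc, hRB, Matrix.mul_zero]
  have hright : E * (H * S) * (R * E) * H * Bᵀ = E * H * Bᵀ := by
    rw [hHS, Matrix.mul_one, ← Matrix.mul_assoc E R E, hER, Matrix.one_mul]
  have hmid : E * (H * S) * H * Bᵀ = E * H * Bᵀ := by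
    rw [hHS, Matrix.mul_one]
  calc (E * H * Bᵀ) * ((B_D * S * B_Dᵀ) * (B * H * Bᵀ))
      = E * H * (Bᵀ * B_D) * S * (B_Dᵀ * B) * H * Bᵀ := by
        simp only [Matrix.mul_assoc]
    _ = E * H * (1 - Eᵀ * Rᵀ) * S * (1 - R * E) * H * Bᵀ := by rw [hQ, hQt]
    _ = E * (H * S) * H * Bᵀ - E * H * (Eᵀ * Rᵀ) * (S * H) * Bᵀ
          - E * (H * S) * (R * E) * H * Bᵀ
          + (E * H * Eᵀ) * (Rᵀ * S * R) * (E * H * Bᵀ) := by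
        simp only [Matrix.mul_sub, Matrix.sub_mul, Matrix.mul_one, Matrix.mul_assoc]
        abel
    _ = (E * H * Eᵀ) * (Rᵀ * S * R) * (E * H * Bᵀ) := by
        rw [hleft, hright, hmid, sub_zero, sub_self, zero_add]
end

section
/- The composition of the transfer matrices satisfies T_D * T_P = I − P_BDDC, i.e., (E*H*Bᵀ)*(B_D*S*R) = I − (E*H*Eᵀ)*(Rᵀ*S*R), where I is the m×m identity. -/
open Matrix

theorem stmt_3 {n m k : ℕ} (hn : 0 < n) (hm : 0 < m) (hk : 0 < k)
    (S : Matrix (Fin n) (Fin n) ℝ) (hS : Sᵀ = S)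
    (R : Matrix (Fin n) (Fin m) ℝ) (E : Matrix (Fin m) (Fin n) ℝ)
    (B B_D : Matrix (Fin k) (Fin n) ℝ)
    (hER : E * R = 1) (hBR : B * R = 0) (hBBD : B * B_Dᵀ = 1)
    (hdec : B_Dᵀ * B + R * E = 1)
    (H : Matrix (Fin n) (Fin n) ℝ) (hH : Hᵀ = H)
    (hHSR : H * S * R = R) (hHSBD : H * S * B_Dᵀ = B_Dᵀ) :
    (E * H * Bᵀ) * (B_D * S * R) = 1 - (E * H * Eᵀ) * (Rᵀ * S * R) := by
  have hdecT : Bᵀ * B_D + Eᵀ * Rᵀ = 1 := by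
    simpa [transpose_add, transpose_mul] using congrArg transpose hdec
  rw [eq_sub_iff_add_eq]
  calc (E * H * Bᵀ) * (B_D * S * R) + (E * H * Eᵀ) * (Rᵀ * S * R)
      = E * H * (Bᵀ * B_D + Eᵀ * Rᵀ) * (S * R) := by
        simp only [Matrix.mul_add, Matrix.add_mul, Matrix.mul_assoc]
    _ = E * (H * S * R) := by
        rw [hdecT, Matrix.mul_one]
        simp only [Matrix.mul_assoc]
    _ = 1 := by rw [hHSR, hER]
end

section
/- The composition of the transfer matrices satisfies T_P * T_D = I − P_FETI, i.e., (B_D*S*R)*(E*H*Bᵀ) = I − (B_D*S*B_Dᵀ)*(B*H*Bᵀ), where I is the k×k identity. -/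
open Matrix

theorem stmt_4 {n m k : ℕ} (hn : 0 < n) (hm : 0 < m) (hk : 0 < k)
    (S : Matrix (Fin n) (Fin n) ℝ) (hS : Sᵀ = S)
    (R : Matrix (Fin n) (Fin m) ℝ) (E : Matrix (Fin m) (Fin n) ℝ)
    (B B_D : Matrix (Fin k) (Fin n) ℝ)
    (hER : E * R = 1) (hBR : B * R = 0) (hBBD : B * B_Dᵀ = 1)
    (hdec : B_Dᵀ * B + R * E = 1)
    (H : Matrix (Fin n) (Fin n) ℝ) (hH : Hᵀ = H)
    (hHSR : H * S * R = R) (hHSBD : H * S * B_Dᵀ = B_Dᵀ) :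
    (B_D * S * R) * (E * H * Bᵀ) = 1 - (B_D * S * B_Dᵀ) * (B * H * Bᵀ) := by
  have hBDSH : B_D * S * H = B_D := by
    simpa [Matrix.transpose_mul, hS, hH, Matrix.mul_assoc] using congrArg Matrix.transpose hHSBD
  have hBDB : B_D * Bᵀ = 1 := by
    simpa [Matrix.transpose_mul] using congrArg Matrix.transpose hBBD
  rw [eq_sub_iff_add_eq]
  calc (B_D * S * R) * (E * H * Bᵀ) + (B_D * S * B_Dᵀ) * (B * H * Bᵀ)
      = B_D * S * (B_Dᵀ * B + R * E) * H * Bᵀ := by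
        simp only [Matrix.mul_add, Matrix.add_mul, Matrix.mul_assoc]
        rw [add_comm]
    _ = 1 := by rw [hdec, Matrix.mul_one, hBDSH, hBDB]
end

section
/- If u is a nonzero vector with P_BDDC u = λ u and λ ≠ 1, then T_P u ≠ 0 and P_FETI (T_P u) = λ (T_P u); that is, every eigenvector of the preconditioned BDDC operator with eigenvalue different from one transfers under T_P to an eigenvector of the preconditioned FETI-DP operator with the same eigenvalue. -/
open Matrix

theorem stmt_5 {n m k : ℕ} (hn : 0 < n) (hm : 0 < m) (hk : 0 < k)
    (S : Matrix (Fin n) (Fin n) ℝ) (hS : Sᵀ = S)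
    (R : Matrix (Fin n) (Fin m) ℝ) (E : Matrix (Fin m) (Fin n) ℝ)
    (B B_D : Matrix (Fin k) (Fin n) ℝ)
    (hER : E * R = 1) (hBR : B * R = 0) (hBBD : B * B_Dᵀ = 1)
    (hdec : B_Dᵀ * B + R * E = 1)
    (H : Matrix (Fin n) (Fin n) ℝ) (hH : Hᵀ = H)
    (hHSR : H * S * R = R) (hHSBD : H * S * B_Dᵀ = B_Dᵀ)
    (u : Fin m → ℝ) (hu : u ≠ 0) (lam : ℝ) (hlam : lam ≠ 1)
    (heig : ((E * H * Eᵀ) * (Rᵀ * S * R)).mulVec u = lam • u) :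
    (B_D * S * R).mulVec u ≠ 0 ∧
      ((B_D * S * B_Dᵀ) * (B * H * Bᵀ)).mulVec ((B_D * S * R).mulVec u) =
        lam • (B_D * S * R).mulVec u := by
  have hHS : H * S = 1 := by
    calc H * S = H * S * (B_Dᵀ * B + R * E) := by rw [hdec, Matrix.mul_one]
      _ = H * S * B_Dᵀ * B + H * S * R * E := by simp only [Matrix.mul_add, Matrix.mul_assoc]
      _ = 1 := by rw [hHSR, hHSBD, hdec]
  have hSH : S * H = 1 := mul_eq_one_comm.mp hHS
  have hBDB : B_D * Bᵀ = 1 := by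
    simpa using congrArg transpose hBBD
  have hdecT : Eᵀ * Rᵀ = 1 - Bᵀ * B_D := by
    rw [eq_sub_iff_add_eq']
    simpa using congrArg transpose hdec
  have hBDDC : (E * H * Eᵀ) * (Rᵀ * S * R) = 1 - (E * H * Bᵀ) * (B_D * S * R) := by
    calc (E * H * Eᵀ) * (Rᵀ * S * R) = E * H * (Eᵀ * Rᵀ) * S * R := by
          simp only [Matrix.mul_assoc]
      _ = E * (H * S * R) - (E * H * Bᵀ) * (B_D * S * R) := by
          rw [hdecT]
          simp only [Matrix.mul_sub, Matrix.sub_mul, Matrix.mul_one, Matrix.mul_assoc]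
      _ = 1 - (E * H * Bᵀ) * (B_D * S * R) := by rw [hHSR, hER]
  have hFETI : (B_D * S * B_Dᵀ) * (B * H * Bᵀ) = 1 - (B_D * S * R) * (E * H * Bᵀ) := by
    calc (B_D * S * B_Dᵀ) * (B * H * Bᵀ) = B_D * S * (B_Dᵀ * B) * H * Bᵀ := by
          simp only [Matrix.mul_assoc]
      _ = B_D * (S * H) * Bᵀ - (B_D * S * R) * (E * H * Bᵀ) := by
          rw [eq_sub_of_add_eq hdec]
          simp only [Matrix.mul_sub, Matrix.sub_mul, Matrix.mul_one, Matrix.mul_assoc]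
      _ = 1 - (B_D * S * R) * (E * H * Bᵀ) := by rw [hSH, Matrix.mul_one, hBDB]
  refine ⟨fun hzero => ?_, ?_⟩
  · rw [hBDDC, sub_mulVec, one_mulVec, ← mulVec_mulVec, hzero, mulVec_zero, sub_zero] at heig
    have hsmul : (1 - lam) • u = 0 := by rw [sub_smul, one_smul, ← heig, sub_self]
    exact (smul_eq_zero.mp hsmul).elim (fun h => hlam (sub_eq_zero.mp h).symm) hu
  · rw [← mulVec_smul, ← heig, hFETI, hBDDC, mulVec_mulVec, mulVec_mulVec]
    congr 1
    simp only [Matrix.mul_sub, Matrix.sub_mul, Matrix.mul_one, Matrix.one_mul, Matrix.mul_assoc]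
end

section
/- If p is a nonzero vector with P_FETI p = λ p and λ ≠ 1, then T_D p ≠ 0 and P_BDDC (T_D p) = λ (T_D p); that is, every eigenvector of the preconditioned FETI-DP operator with eigenvalue different from one transfers under T_D to an eigenvector of the preconditioned BDDC operator with the same eigenvalue. -/
open Matrix

theorem stmt_6 {n m k : ℕ} (hn : 0 < n) (hm : 0 < m) (hk : 0 < k)
    (S : Matrix (Fin n) (Fin n) ℝ) (hS : Sᵀ = S)
    (R : Matrix (Fin n) (Fin m) ℝ) (E : Matrix (Fin m) (Fin n) ℝ)
    (B B_D : Matrix (Fin k) (Fin n) ℝ)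
    (hER : E * R = 1) (hBR : B * R = 0) (hBBD : B * B_Dᵀ = 1)
    (hdec : B_Dᵀ * B + R * E = 1)
    (H : Matrix (Fin n) (Fin n) ℝ) (hH : Hᵀ = H)
    (hHSR : H * S * R = R) (hHSBD : H * S * B_Dᵀ = B_Dᵀ)
    (p : Fin k → ℝ) (hp : p ≠ 0) (lam : ℝ) (hlam : lam ≠ 1)
    (heig : ((B_D * S * B_Dᵀ) * (B * H * Bᵀ)).mulVec p = lam • p) :
    (E * H * Bᵀ).mulVec p ≠ 0 ∧
      ((E * H * Eᵀ) * (Rᵀ * S * R)).mulVec ((E * H * Bᵀ).mulVec p) =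
        lam • (E * H * Bᵀ).mulVec p := by
  have hHS : H * S = 1 := by
    calc H * S = H * S * (B_Dᵀ * B + R * E) := by rw [hdec, Matrix.mul_one]
      _ = 1 := by
        rw [Matrix.mul_add, ← Matrix.mul_assoc, ← Matrix.mul_assoc, hHSBD, hHSR, hdec]
  have hSH : S * H = 1 := mul_eq_one_comm.mp hHS
  have hRE : R * E = 1 - B_Dᵀ * B := eq_sub_of_add_eq' hdec
  have hREt : Eᵀ * Rᵀ = 1 - Bᵀ * B_D := by
    simpa using congrArg Matrix.transpose hRE
  have hBDB : B_D * Bᵀ = 1 := by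
    simpa using congrArg Matrix.transpose hBBD
  have hEBD : E * B_Dᵀ = 0 := by
    calc E * B_Dᵀ = E * (R * E) * B_Dᵀ := by
          rw [← Matrix.mul_assoc, hER, Matrix.one_mul]
      _ = 0 := by
        rw [hRE, Matrix.mul_assoc, Matrix.sub_mul, Matrix.mul_assoc, hBBD, Matrix.mul_one,
          Matrix.one_mul, sub_self, Matrix.mul_zero]
  have hX : S * (R * E) * (H * Bᵀ) = Bᵀ - S * B_Dᵀ * (B * H * Bᵀ) := by
    rw [hRE, Matrix.mul_sub, Matrix.sub_mul, Matrix.mul_one, ← Matrix.mul_assoc S H, hSH,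
      Matrix.one_mul]
    simp only [Matrix.mul_assoc]
  have hBDX : B_D * (S * (R * E) * (H * Bᵀ)) = 1 - B_D * S * B_Dᵀ * (B * H * Bᵀ) := by
    rw [hX, Matrix.mul_sub, hBDB]
    simp only [Matrix.mul_assoc]
  have hinter : E * H * Eᵀ * (Rᵀ * S * R) * (E * H * Bᵀ) =
      E * H * Bᵀ * (B_D * S * B_Dᵀ * (B * H * Bᵀ)) := by
    calc E * H * Eᵀ * (Rᵀ * S * R) * (E * H * Bᵀ)
        = E * H * ((Eᵀ * Rᵀ) * (S * (R * E) * (H * Bᵀ))) := by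
          simp only [Matrix.mul_assoc]
      _ = E * H * (Bᵀ * (B_D * S * B_Dᵀ * (B * H * Bᵀ)) - S * B_Dᵀ * (B * H * Bᵀ)) := by
          rw [hREt, Matrix.sub_mul, Matrix.one_mul, Matrix.mul_assoc Bᵀ, hBDX, hX,
            Matrix.mul_sub Bᵀ, Matrix.mul_one]
          congr 1
          abel
      _ = E * H * Bᵀ * (B_D * S * B_Dᵀ * (B * H * Bᵀ)) -
            E * (H * S) * B_Dᵀ * (B * H * Bᵀ) := by
          rw [Matrix.mul_sub]
          simp only [Matrix.mul_assoc]
      _ = E * H * Bᵀ * (B_D * S * B_Dᵀ * (B * H * Bᵀ)) := by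
          rw [hHS, Matrix.mul_one, hEBD, Matrix.zero_mul, sub_zero]
  constructor
  · intro h0
    have hTP : (B_D * S * R) * (E * H * Bᵀ) = 1 - B_D * S * B_Dᵀ * (B * H * Bᵀ) := by
      rw [← hBDX]
      simp only [Matrix.mul_assoc]
    have h1 := congrArg (fun M => M *ᵥ p) hTP
    simp only [← Matrix.mulVec_mulVec (M := B_D * S * R), h0, Matrix.mulVec_zero,
      Matrix.sub_mulVec, Matrix.one_mulVec, heig] at h1
    have h2 : (1 - lam) • p = 0 := by rw [sub_smul, one_smul, ← h1]
    rcases smul_eq_zero.mp h2 with h | h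
    · exact hlam (sub_eq_zero.mp h).symm
    · exact hp h
  · rw [Matrix.mulVec_mulVec, hinter, ← Matrix.mulVec_mulVec, heig, Matrix.mulVec_smul]
end

section
/- (Theorem 1 / Lemma 1 of the paper.) The eigenvalues of the preconditioned BDDC operator P_BDDC and of the preconditioned FETI-DP operator P_FETI are the same except possibly for the eigenvalues equal to zero and one: for every real λ with λ ≠ 0 and λ ≠ 1, λ is an eigenvalue of P_BDDC (i.e., there is a nonzero u with P_BDDC u = λ u) if and only if λ is an eigenvalue of P_FETI. -/
open Matrix

/-- Eigenvectors of `1 - Y * W` for an eigenvalue other than `1` are carried by `W` to eigenvectors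
of `1 - W * Y`. -/
theorem exists_eigenvector_one_sub_mul_comm {K ι κ : Type*} [Field K] [Fintype ι] [DecidableEq ι]
    [Fintype κ] [DecidableEq κ] (Y : Matrix ι κ K) (W : Matrix κ ι K) {c : K} (hc : c ≠ 1)
    (h : ∃ u : ι → K, u ≠ 0 ∧ (1 - Y * W).mulVec u = c • u) :
    ∃ p : κ → K, p ≠ 0 ∧ (1 - W * Y).mulVec p = c • p := by
  obtain ⟨u, hu, hPu⟩ := h
  have hYW : Y *ᵥ (W *ᵥ u) = (1 - c) • u := by
    rw [sub_mulVec, one_mulVec, ← mulVec_mulVec] at hPu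
    rw [sub_smul, one_smul, ← hPu, sub_sub_cancel]
  refine ⟨W *ᵥ u, fun hW => ?_, ?_⟩
  · rw [hW, mulVec_zero] at hYW
    exact smul_ne_zero (sub_ne_zero.2 hc.symm) hu hYW.symm
  · rw [sub_mulVec, one_mulVec, ← mulVec_mulVec, hYW, mulVec_smul, sub_smul, one_smul,
      sub_sub_cancel]

theorem stmt_7 {n m k : ℕ} (hn : 0 < n) (hm : 0 < m) (hk : 0 < k)
    (S : Matrix (Fin n) (Fin n) ℝ) (hS : Sᵀ = S)
    (R : Matrix (Fin n) (Fin m) ℝ) (E : Matrix (Fin m) (Fin n) ℝ)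
    (B B_D : Matrix (Fin k) (Fin n) ℝ)
    (hER : E * R = 1) (hBR : B * R = 0) (hBBD : B * B_Dᵀ = 1)
    (hdec : B_Dᵀ * B + R * E = 1)
    (H : Matrix (Fin n) (Fin n) ℝ) (hH : Hᵀ = H)
    (hHSR : H * S * R = R) (hHSBD : H * S * B_Dᵀ = B_Dᵀ)
    (lam : ℝ) (hlam0 : lam ≠ 0) (hlam1 : lam ≠ 1) :
    (∃ u : Fin m → ℝ, u ≠ 0 ∧ ((E * H * Eᵀ) * (Rᵀ * S * R)).mulVec u = lam • u) ↔
      (∃ p : Fin k → ℝ, p ≠ 0 ∧ ((B_D * S * B_Dᵀ) * (B * H * Bᵀ)).mulVec p = lam • p) := by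
  have hHS : H * S = 1 := by
    calc H * S = H * S * (B_Dᵀ * B + R * E) := by rw [hdec, Matrix.mul_one]
      _ = H * S * B_Dᵀ * B + H * S * R * E := by simp only [Matrix.mul_add, Matrix.mul_assoc]
      _ = 1 := by rw [hHSR, hHSBD, hdec]
  have hSH : S * H = 1 := mul_eq_one_comm.1 hHS
  have hBDB : B_D * Bᵀ = 1 := by simpa using congrArg transpose hBBD
  have hdecT : Eᵀ * Rᵀ = 1 - Bᵀ * B_D := by
    have h := congrArg transpose hdec
    simp only [transpose_add, transpose_mul, transpose_transpose, transpose_one] at h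
    exact eq_sub_of_add_eq' h
  have hBDDC : (E * H * Eᵀ) * (Rᵀ * S * R) = 1 - (E * H * Bᵀ) * (B_D * S * R) := by
    calc (E * H * Eᵀ) * (Rᵀ * S * R) = E * H * (Eᵀ * Rᵀ) * S * R := by
          simp only [Matrix.mul_assoc]
      _ = E * (H * S * R) - (E * H * Bᵀ) * (B_D * S * R) := by
          rw [hdecT]
          simp only [Matrix.mul_sub, Matrix.sub_mul, Matrix.mul_one, Matrix.mul_assoc]
      _ = 1 - (E * H * Bᵀ) * (B_D * S * R) := by rw [hHSR, hER]
  have hFETI : (B_D * S * B_Dᵀ) * (B * H * Bᵀ) = 1 - (B_D * S * R) * (E * H * Bᵀ) := by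
    calc (B_D * S * B_Dᵀ) * (B * H * Bᵀ) = B_D * S * (B_Dᵀ * B) * H * Bᵀ := by
          simp only [Matrix.mul_assoc]
      _ = B_D * (S * H) * Bᵀ - (B_D * S * R) * (E * H * Bᵀ) := by
          rw [eq_sub_of_add_eq hdec]
          simp only [Matrix.mul_sub, Matrix.sub_mul, Matrix.mul_one, Matrix.mul_assoc]
      _ = 1 - (B_D * S * R) * (E * H * Bᵀ) := by rw [hSH, Matrix.mul_one, hBDB]
  rw [hBDDC, hFETI]
  exact ⟨exists_eigenvector_one_sub_mul_comm _ _ hlam1,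
    exists_eigenvector_one_sub_mul_comm _ _ hlam1⟩
end

section
/- The four auxiliary vanishing identities used in the appendix proof hold: (a) B_D*S*H*(R*E)ᵀ*S*R = 0, (b) B_D*S*B_Dᵀ*B*H*S*R = 0, (c) E*H*S*B_Dᵀ*B*H*Bᵀ = 0, and (d) E*H*(R*E)ᵀ*S*H*Bᵀ = 0. -/
open Matrix

theorem stmt_8 {n m k : ℕ} (hn : 0 < n) (hm : 0 < m) (hk : 0 < k)
    (S : Matrix (Fin n) (Fin n) ℝ) (hS : Sᵀ = S)
    (R : Matrix (Fin n) (Fin m) ℝ) (E : Matrix (Fin m) (Fin n) ℝ)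
    (B B_D : Matrix (Fin k) (Fin n) ℝ)
    (hER : E * R = 1) (hBR : B * R = 0) (hBBD : B * B_Dᵀ = 1)
    (hdec : B_Dᵀ * B + R * E = 1)
    (H : Matrix (Fin n) (Fin n) ℝ) (hH : Hᵀ = H)
    (hHSR : H * S * R = R) (hHSBD : H * S * B_Dᵀ = B_Dᵀ) :
    B_D * S * H * (R * E)ᵀ * S * R = 0 ∧
    B_D * S * B_Dᵀ * B * H * S * R = 0 ∧
    E * H * S * B_Dᵀ * B * H * Bᵀ = 0 ∧
    E * H * (R * E)ᵀ * S * H * Bᵀ = 0 := by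
  have hHS : H * S = 1 := by
    have h : H * S * (B_Dᵀ * B + R * E) = B_Dᵀ * B + R * E := by
      rw [Matrix.mul_add, ← Matrix.mul_assoc, ← Matrix.mul_assoc, hHSBD, hHSR]
    rwa [hdec, Matrix.mul_one] at h
  have hSH : S * H = 1 := mul_eq_one_comm.mp hHS
  have hEBD : E * B_Dᵀ = 0 := by
    have h := congrArg (fun M => E * M * B_Dᵀ) hdec
    simpa only [Matrix.mul_add, Matrix.add_mul, ← Matrix.mul_assoc, hER, Matrix.one_mul,
      Matrix.mul_one, Matrix.mul_assoc _ B, hBBD, add_eq_left] using h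
  have hBDE : B_D * Eᵀ = 0 := by
    simpa using congrArg Matrix.transpose hEBD
  have hRB : Rᵀ * Bᵀ = 0 := by
    simpa using congrArg Matrix.transpose hBR
  refine ⟨?_, ?_, ?_, ?_⟩
  · rw [Matrix.mul_assoc B_D, hSH, Matrix.mul_one, Matrix.transpose_mul, ← Matrix.mul_assoc,
      hBDE]
    simp only [Matrix.zero_mul]
  · rw [Matrix.mul_assoc _ H, Matrix.mul_assoc _ (H * S), hHSR, Matrix.mul_assoc, hBR,
      Matrix.mul_zero]
  · rw [Matrix.mul_assoc E, hHS, Matrix.mul_one, hEBD]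
    simp only [Matrix.zero_mul]
  · rw [Matrix.mul_assoc _ S, hSH, Matrix.mul_one, Matrix.transpose_mul, Matrix.mul_assoc,
      Matrix.mul_assoc Eᵀ, hRB, Matrix.mul_zero, Matrix.mul_zero]
end

section
/- The saddle-point FETI-DP matrix [[S_c, Ψᵀ*Bᵀ], [B*Ψ, −B*S_Δinv*Bᵀ]] is invertible and its inverse equals [[I, −S_c⁻¹*Ψᵀ*Bᵀ], [0, I]] * [[S_c⁻¹, 0], [F⁻¹*B*Ψ*S_c⁻¹, −F⁻¹]], where F = B*(Ψ*S_c⁻¹*Ψᵀ + S_Δinv)*Bᵀ is the FETI-DP matrix (equation (eq:block-dec-bddc-dp) of the paper). -/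
open Matrix

noncomputable section

/-- The saddle-point matrix `K = [[S, Cᵀ], [C, 0]]`. -/
def Kmat {n c : ℕ} (S : Matrix (Fin n) (Fin n) ℝ) (C : Matrix (Fin c) (Fin n) ℝ) :
    Matrix (Fin n ⊕ Fin c) (Fin n ⊕ Fin c) ℝ :=
  fromBlocks S Cᵀ C 0

/-- `S_Δ⁻¹`, the upper-left `n×n` block of `K⁻¹`. -/
def SDelta {n c : ℕ} (S : Matrix (Fin n) (Fin n) ℝ) (C : Matrix (Fin c) (Fin n) ℝ) :
    Matrix (Fin n) (Fin n) ℝ :=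
  ((Kmat S C)⁻¹).toBlocks₁₁

/-- The energy-minimal coarse basis `Ψ = (I − S_Δ⁻¹ S) Φ`. -/
def Psi {n c q : ℕ} (S : Matrix (Fin n) (Fin n) ℝ) (C : Matrix (Fin c) (Fin n) ℝ)
    (Φ : Matrix (Fin n) (Fin q) ℝ) : Matrix (Fin n) (Fin q) ℝ :=
  (1 - SDelta S C * S) * Φ

/-- The coarse matrix `S_c = Φᵀ S Φ − [S Φ; 0]ᵀ K⁻¹ [S Φ; 0]`. -/
def Sc {n c q : ℕ} (S : Matrix (Fin n) (Fin n) ℝ) (C : Matrix (Fin c) (Fin n) ℝ)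
    (Φ : Matrix (Fin n) (Fin q) ℝ) : Matrix (Fin q) (Fin q) ℝ :=
  Φᵀ * S * Φ -
    (fromRows (S * Φ) (0 : Matrix (Fin c) (Fin q) ℝ))ᵀ * (Kmat S C)⁻¹ *
      fromRows (S * Φ) (0 : Matrix (Fin c) (Fin q) ℝ)

end

/-- Block factorization of the inverse of `[[A, U], [V, -D]]` through the (negated) Schur complement
`V * A⁻¹ * U + D`. -/
theorem fromBlocks_mul_schur_factorization {m l R : Type*} [Fintype m] [DecidableEq m]
    [Fintype l] [DecidableEq l] [CommRing R] (A : Matrix m m R) (U : Matrix m l R)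
    (V : Matrix l m R) (D : Matrix l l R) (hA : IsUnit A) (hF : IsUnit (V * A⁻¹ * U + D)) :
    fromBlocks A U V (-D) *
        (fromBlocks 1 (-(A⁻¹ * U)) 0 1 *
          fromBlocks A⁻¹ 0 ((V * A⁻¹ * U + D)⁻¹ * V * A⁻¹) (-(V * A⁻¹ * U + D)⁻¹)) = 1 := by
  have hA' : A * A⁻¹ = 1 := mul_nonsing_inv A ((isUnit_iff_isUnit_det A).mp hA)
  have hF' : (V * A⁻¹ * U + D) * (V * A⁻¹ * U + D)⁻¹ = 1 :=
    mul_nonsing_inv _ ((isUnit_iff_isUnit_det _).mp hF)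
  have hleft : fromBlocks A U V (-D) * fromBlocks 1 (-(A⁻¹ * U)) 0 1 =
      fromBlocks A 0 V (-(V * A⁻¹ * U + D)) := by
    simp [fromBlocks_multiply, ← Matrix.mul_assoc, hA', add_comm]
  generalize V * A⁻¹ * U + D = F at *
  rw [← Matrix.mul_assoc, hleft, fromBlocks_multiply]
  simp [← Matrix.mul_assoc, hA', hF', fromBlocks_one]

theorem stmt_10 {n c q k : ℕ} (hn : 0 < n) (hc : 0 < c) (hq : 0 < q) (hk : 0 < k)
    (S : Matrix (Fin n) (Fin n) ℝ) (hS : Sᵀ = S)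
    (C : Matrix (Fin c) (Fin n) ℝ) (hK : IsUnit (Kmat S C))
    (Φ : Matrix (Fin n) (Fin q) ℝ) (R_c : Matrix (Fin c) (Fin q) ℝ) (hCΦ : C * Φ = R_c)
    (B : Matrix (Fin k) (Fin n) ℝ)
    (hSc : IsUnit (Sc S C Φ))
    (hF : IsUnit (B * (Psi S C Φ * (Sc S C Φ)⁻¹ * (Psi S C Φ)ᵀ + SDelta S C) * Bᵀ)) :
    IsUnit (fromBlocks (Sc S C Φ) ((Psi S C Φ)ᵀ * Bᵀ) (B * Psi S C Φ)
        (-(B * SDelta S C * Bᵀ))) ∧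
      (fromBlocks (Sc S C Φ) ((Psi S C Φ)ᵀ * Bᵀ) (B * Psi S C Φ)
          (-(B * SDelta S C * Bᵀ)))⁻¹ =
        fromBlocks 1 (-((Sc S C Φ)⁻¹ * (Psi S C Φ)ᵀ * Bᵀ)) 0 1 *
          fromBlocks (Sc S C Φ)⁻¹ 0
            ((B * (Psi S C Φ * (Sc S C Φ)⁻¹ * (Psi S C Φ)ᵀ + SDelta S C) * Bᵀ)⁻¹ *
              (B * Psi S C Φ) * (Sc S C Φ)⁻¹)
            (-(B * (Psi S C Φ * (Sc S C Φ)⁻¹ * (Psi S C Φ)ᵀ + SDelta S C) * Bᵀ)⁻¹) := by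
  have hFeq : B * (Psi S C Φ * (Sc S C Φ)⁻¹ * (Psi S C Φ)ᵀ + SDelta S C) * Bᵀ =
      B * Psi S C Φ * (Sc S C Φ)⁻¹ * ((Psi S C Φ)ᵀ * Bᵀ) + B * SDelta S C * Bᵀ := by
    simp only [Matrix.mul_add, Matrix.add_mul, Matrix.mul_assoc]
  rw [hFeq] at hF ⊢
  have hmul := fromBlocks_mul_schur_factorization (Sc S C Φ) ((Psi S C Φ)ᵀ * Bᵀ) (B * Psi S C Φ)
    (B * SDelta S C * Bᵀ) hSc hF
  rw [← Matrix.mul_assoc (Sc S C Φ)⁻¹] at hmul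
  exact ⟨IsUnit.of_mul_eq_one _ hmul, inv_eq_right_inv hmul⟩
end

section
/- Eliminating the coarse unknown from the saddle-point FETI-DP system yields the original FETI-DP system: for any vector g of size n, a pair (u_c, λ) satisfies S_c*u_c + Ψᵀ*Bᵀ*λ = Ψᵀ*g and B*Ψ*u_c − B*S_Δinv*Bᵀ*λ = −B*S_Δinv*g if and only if B*(Ψ*S_c⁻¹*Ψᵀ + S_Δinv)*Bᵀ*λ = B*(Ψ*S_c⁻¹*Ψᵀ + S_Δinv)*g and u_c = S_c⁻¹*Ψᵀ*(g − Bᵀ*λ). -/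
open Matrix

/-- Eliminating the first unknown of a block system through the Schur complement of an
invertible pivot block. -/
theorem saddle_point_iff_schur_complement {R m n k : Type*} [CommRing R] [Fintype m]
    [DecidableEq m] [Fintype n] [Fintype k]
    {A : Matrix m m R} (hA : IsUnit A) (P : Matrix n m R) (D : Matrix n n R)
    (B : Matrix k n R) (g : n → R) (u : m → R) (l : k → R) :
    (A *ᵥ u + (Pᵀ * Bᵀ) *ᵥ l = Pᵀ *ᵥ g ∧
        (B * P) *ᵥ u - (B * D * Bᵀ) *ᵥ l = -((B * D) *ᵥ g)) ↔
      ((B * (P * A⁻¹ * Pᵀ + D) * Bᵀ) *ᵥ l = (B * (P * A⁻¹ * Pᵀ + D)) *ᵥ g ∧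
        u = (A⁻¹ * Pᵀ) *ᵥ (g - Bᵀ *ᵥ l)) := by
  have hdet := (isUnit_iff_isUnit_det A).mp hA
  have hu : A *ᵥ u + (Pᵀ * Bᵀ) *ᵥ l = Pᵀ *ᵥ g ↔ u = (A⁻¹ * Pᵀ) *ᵥ (g - Bᵀ *ᵥ l) := by
    rw [← eq_sub_iff_add_eq, ← mulVec_mulVec, ← mulVec_sub, ← mulVec_mulVec]
    constructor
    · intro h
      rw [← h, mulVec_mulVec, nonsing_inv_mul A hdet, one_mulVec]
    · rintro rfl
      rw [mulVec_mulVec, mul_nonsing_inv A hdet, one_mulVec]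
  rw [hu, and_comm]
  refine and_congr_left fun h => ?_
  subst h
  simp only [Matrix.mul_add, Matrix.add_mul, add_mulVec, mulVec_sub, mulVec_mulVec,
    Matrix.mul_assoc]
  constructor <;> intro h <;> linear_combination -h

theorem stmt_11 {n c q k : ℕ} (hn : 0 < n) (hc : 0 < c) (hq : 0 < q) (hk : 0 < k)
    (S : Matrix (Fin n) (Fin n) ℝ) (hS : Sᵀ = S)
    (C : Matrix (Fin c) (Fin n) ℝ) (hK : IsUnit (Kmat S C))
    (Φ : Matrix (Fin n) (Fin q) ℝ) (R_c : Matrix (Fin c) (Fin q) ℝ) (hCΦ : C * Φ = R_c)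
    (B : Matrix (Fin k) (Fin n) ℝ)
    (hSc : IsUnit (Sc S C Φ))
    (g : Fin n → ℝ) (u_c : Fin q → ℝ) (lam : Fin k → ℝ) :
    ((Sc S C Φ).mulVec u_c + ((Psi S C Φ)ᵀ * Bᵀ).mulVec lam = (Psi S C Φ)ᵀ.mulVec g ∧
        (B * Psi S C Φ).mulVec u_c - (B * SDelta S C * Bᵀ).mulVec lam =
          -(B * SDelta S C).mulVec g) ↔
      ((B * (Psi S C Φ * (Sc S C Φ)⁻¹ * (Psi S C Φ)ᵀ + SDelta S C) * Bᵀ).mulVec lam =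
          (B * (Psi S C Φ * (Sc S C Φ)⁻¹ * (Psi S C Φ)ᵀ + SDelta S C)).mulVec g ∧
        u_c = ((Sc S C Φ)⁻¹ * (Psi S C Φ)ᵀ).mulVec (g - Bᵀ.mulVec lam)) := by
  exact saddle_point_iff_schur_complement hSc (Psi S C Φ) (SDelta S C) B g u_c lam
end

section
/- Eigenvalue analysis of the preconditioned saddle-point operator, case μ = 1: suppose the pair (u, p) is not the zero vector and satisfies the eigenvalue equations M_c*S_c*u + M_c*Ψᵀ*Bᵀ*p = λ*u and M_D*B*Ψ*(M_c*S_c − I)*u + M_D*B*(Ψ*M_c*Ψᵀ + S_Δinv)*Bᵀ*p = λ*p, and suppose M_c*S_c*u = u and λ ≠ 1. Then p ≠ 0, u = (λ−1)⁻¹ * M_c*Ψᵀ*Bᵀ*p, and M_D*B*(Ψ*M_c*Ψᵀ + S_Δinv)*Bᵀ*p = λ*p; in particular λ is an eigenvalue of the inexact preconditioned FETI-DP operator M_D*B*(Ψ*M_c*Ψᵀ + S_Δinv)*Bᵀ. -/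
open Matrix

theorem stmt_13 {n c q k : ℕ} (hn : 0 < n) (hc : 0 < c) (hq : 0 < q) (hk : 0 < k)
    (S : Matrix (Fin n) (Fin n) ℝ) (hS : Sᵀ = S)
    (C : Matrix (Fin c) (Fin n) ℝ) (hK : IsUnit (Kmat S C))
    (Φ : Matrix (Fin n) (Fin q) ℝ) (R_c : Matrix (Fin c) (Fin q) ℝ) (hCΦ : C * Φ = R_c)
    (B : Matrix (Fin k) (Fin n) ℝ)
    (M_c : Matrix (Fin q) (Fin q) ℝ) (M_D : Matrix (Fin k) (Fin k) ℝ)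
    (u : Fin q → ℝ) (p : Fin k → ℝ) (hup : ¬(u = 0 ∧ p = 0)) (lam : ℝ)
    (heig1 : (M_c * Sc S C Φ).mulVec u + (M_c * (Psi S C Φ)ᵀ * Bᵀ).mulVec p = lam • u)
    (heig2 : (M_D * B * Psi S C Φ * (M_c * Sc S C Φ - 1)).mulVec u +
        (M_D * B * (Psi S C Φ * M_c * (Psi S C Φ)ᵀ + SDelta S C) * Bᵀ).mulVec p = lam • p)
    (hmu : (M_c * Sc S C Φ).mulVec u = u) (hlam : lam ≠ 1) :
    p ≠ 0 ∧
      u = (lam - 1)⁻¹ • (M_c * (Psi S C Φ)ᵀ * Bᵀ).mulVec p ∧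
      (M_D * B * (Psi S C Φ * M_c * (Psi S C Φ)ᵀ + SDelta S C) * Bᵀ).mulVec p = lam • p := by
  have hne : lam - 1 ≠ 0 := sub_ne_zero.mpr hlam
  have hu : u = (lam - 1)⁻¹ • (M_c * (Psi S C Φ)ᵀ * Bᵀ).mulVec p := by
    rw [hmu] at heig1
    rw [eq_inv_smul_iff₀ hne, sub_smul, one_smul, ← heig1, add_sub_cancel_left]
  refine ⟨fun hp => hup ⟨?_, hp⟩, hu, ?_⟩
  · rw [hu, hp, mulVec_zero, smul_zero]
  · rwa [← mulVec_mulVec, sub_mulVec, hmu, one_mulVec, sub_self, mulVec_zero, zero_add] at heig2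
end

section
/- Eigenvalue analysis of the preconditioned saddle-point operator, case μ ≠ 1: suppose the pair (u, p) satisfies the eigenvalue equations M_c*S_c*u + M_c*Ψᵀ*Bᵀ*p = λ*u and M_D*B*Ψ*(M_c*S_c − I)*u + M_D*B*(Ψ*M_c*Ψᵀ + S_Δinv)*Bᵀ*p = λ*p, and suppose M_c*S_c*u = μ*u with μ ≠ 1 and λ ≠ μ. Then u = (λ−μ)⁻¹ * M_c*Ψᵀ*Bᵀ*p and M_D*B*( ((μ−1)/(λ−μ) + 1) * Ψ*M_c*Ψᵀ + S_Δinv )*Bᵀ*p = λ*p; in particular, if λ = 1 this reduces to M_D*B*S_Δinv*Bᵀ*p = p. -/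
open Matrix

/-- Block elimination of an eigenvector component `u` of a preconditioned saddle-point operator, when
`u` is an eigenvector of `A`. The matrices `Ψ`, `Ψ'`, `D` and `E` are arbitrary. -/
theorem eliminate_coarse_component {𝕜 m n q k : Type*} [Field 𝕜] [Fintype m] [Fintype n]
    [Fintype q] [DecidableEq q] [Fintype k] (A : Matrix q q 𝕜) (M : Matrix q q 𝕜)
    (Ψ : Matrix n q 𝕜) (Ψ' : Matrix q m 𝕜) (D : Matrix n m 𝕜) (E : Matrix k n 𝕜)
    (F : Matrix m k 𝕜) (u : q → 𝕜) (p : k → 𝕜) (lam mu : 𝕜)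
    (h₁ : A *ᵥ u + (M * Ψ' * F) *ᵥ p = lam • u)
    (h₂ : (E * Ψ * (A - 1)) *ᵥ u + (E * (Ψ * M * Ψ' + D) * F) *ᵥ p = lam • p)
    (hmu : A *ᵥ u = mu • u) (hne : lam ≠ mu) :
    u = (lam - mu)⁻¹ • (M * Ψ' * F) *ᵥ p ∧
      (E * (((mu - 1) / (lam - mu) + 1) • (Ψ * M * Ψ') + D) * F) *ᵥ p = lam • p := by
  have hsub : lam - mu ≠ 0 := sub_ne_zero.mpr hne
  have hv : (M * Ψ' * F) *ᵥ p = (lam - mu) • u := by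
    rw [sub_smul, ← h₁, hmu, add_sub_cancel_left]
  have hsplit (a : 𝕜) : (E * (a • (Ψ * M * Ψ') + D) * F) *ᵥ p =
      (a * (lam - mu)) • (E * Ψ) *ᵥ u + (E * D * F) *ᵥ p := by
    have hX : (E * (Ψ * M * Ψ') * F) *ᵥ p = (lam - mu) • (E * Ψ) *ᵥ u := by
      rw [← mulVec_smul, ← hv, mulVec_mulVec]
      simp only [Matrix.mul_assoc]
    rw [Matrix.mul_add, Matrix.add_mul, add_mulVec, Matrix.mul_smul, Matrix.smul_mul,
      smul_mulVec, hX, smul_smul]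
  refine ⟨by rw [hv, inv_smul_smul₀ hsub], ?_⟩
  have hu : (E * Ψ * (A - 1)) *ᵥ u = (mu - 1) • (E * Ψ) *ᵥ u := by
    rw [← mulVec_mulVec, sub_mulVec, hmu, one_mulVec, ← mulVec_smul, sub_smul, one_smul]
  have hone := hsplit 1
  rw [one_smul] at hone
  rw [hu, hone, ← add_assoc, ← add_smul] at h₂
  rw [hsplit, ← h₂, add_mul, div_mul_cancel₀ _ hsub]

theorem stmt_14 {n c q k : ℕ} (hn : 0 < n) (hc : 0 < c) (hq : 0 < q) (hk : 0 < k)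
    (S : Matrix (Fin n) (Fin n) ℝ) (hS : Sᵀ = S)
    (C : Matrix (Fin c) (Fin n) ℝ) (hK : IsUnit (Kmat S C))
    (Φ : Matrix (Fin n) (Fin q) ℝ) (R_c : Matrix (Fin c) (Fin q) ℝ) (hCΦ : C * Φ = R_c)
    (B : Matrix (Fin k) (Fin n) ℝ)
    (M_c : Matrix (Fin q) (Fin q) ℝ) (M_D : Matrix (Fin k) (Fin k) ℝ)
    (u : Fin q → ℝ) (p : Fin k → ℝ) (lam mu : ℝ)
    (heig1 : (M_c * Sc S C Φ).mulVec u + (M_c * (Psi S C Φ)ᵀ * Bᵀ).mulVec p = lam • u)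
    (heig2 : (M_D * B * Psi S C Φ * (M_c * Sc S C Φ - 1)).mulVec u +
        (M_D * B * (Psi S C Φ * M_c * (Psi S C Φ)ᵀ + SDelta S C) * Bᵀ).mulVec p = lam • p)
    (hmu : (M_c * Sc S C Φ).mulVec u = mu • u) (hmu1 : mu ≠ 1) (hlammu : lam ≠ mu) :
    u = (lam - mu)⁻¹ • (M_c * (Psi S C Φ)ᵀ * Bᵀ).mulVec p ∧
      (M_D * B *
          (((mu - 1) / (lam - mu) + 1) • (Psi S C Φ * M_c * (Psi S C Φ)ᵀ) + SDelta S C) *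
          Bᵀ).mulVec p = lam • p ∧
      (lam = 1 → (M_D * B * SDelta S C * Bᵀ).mulVec p = p) := by
  obtain ⟨hu, hp⟩ := eliminate_coarse_component _ M_c (Psi S C Φ) (Psi S C Φ)ᵀ (SDelta S C)
    (M_D * B) Bᵀ u p lam mu heig1 heig2 hmu hlammu
  refine ⟨hu, hp, ?_⟩
  rintro rfl
  have hcoef : (mu - 1) / (1 - mu) + 1 = 0 := by
    rw [← neg_sub, neg_div, div_self (sub_ne_zero.mpr hlammu), neg_add_cancel]
  rwa [hcoef, zero_smul, zero_add, one_smul] at hp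
end

section
/- The two expressions for the coarse matrix coincide: S_c = Ψᵀ*S*Ψ, i.e., Φᵀ*S*Φ − [S*Φ; 0]ᵀ * K⁻¹ * [S*Φ; 0] = Ψᵀ*S*Ψ (the second equality in equation (eq:coarse_matrix) of the paper). -/
open Matrix

theorem transpose_SDelta {n c : ℕ} {S : Matrix (Fin n) (Fin n) ℝ} (hS : Sᵀ = S)
    (C : Matrix (Fin c) (Fin n) ℝ) : (SDelta S C)ᵀ = SDelta S C := by
  have hK : (Kmat S C)ᵀ = Kmat S C := by
    simp [Kmat, fromBlocks_transpose, hS]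
  have h : ((Kmat S C)⁻¹)ᵀ = (Kmat S C)⁻¹ := by
    rw [transpose_nonsing_inv, hK]
  ext i j
  exact congrFun (congrFun h (Sum.inl i)) (Sum.inl j)

theorem SDelta_mul_mul_SDelta {n c : ℕ} {S : Matrix (Fin n) (Fin n) ℝ}
    {C : Matrix (Fin c) (Fin n) ℝ} (hK : IsUnit (Kmat S C)) :
    SDelta S C * S * SDelta S C = SDelta S C := by
  have hdet := (isUnit_iff_isUnit_det _).mp hK
  have hr := mul_nonsing_inv _ hdet
  have hl := nonsing_inv_mul _ hdet
  rw [← fromBlocks_toBlocks (Kmat S C)⁻¹, Kmat, fromBlocks_multiply, ← fromBlocks_one,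
    fromBlocks_inj] at hr hl
  have h₁ : S * SDelta S C + Cᵀ * ((Kmat S C)⁻¹).toBlocks₂₁ = 1 := hr.1
  have h₂ : SDelta S C * Cᵀ = 0 := by
    simpa [SDelta, Kmat] using hl.2.1
  rw [Matrix.mul_assoc, eq_sub_of_add_eq h₁, Matrix.mul_sub, ← Matrix.mul_assoc, h₂,
    Matrix.zero_mul, sub_zero, Matrix.mul_one]

theorem Sc_eq {n c q : ℕ} {S : Matrix (Fin n) (Fin n) ℝ} (hS : Sᵀ = S)
    (C : Matrix (Fin c) (Fin n) ℝ) (Φ : Matrix (Fin n) (Fin q) ℝ) :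
    Sc S C Φ = Φᵀ * (S - S * SDelta S C * S) * Φ := by
  rw [Sc, ← fromBlocks_toBlocks (Kmat S C)⁻¹, transpose_fromRows, fromCols_mul_fromBlocks,
    fromCols_mul_fromRows]
  simp [SDelta, hS, Matrix.mul_sub, Matrix.sub_mul, Matrix.mul_assoc]

theorem stmt_15 {n c q : ℕ} (hn : 0 < n) (hc : 0 < c) (hq : 0 < q)
    (S : Matrix (Fin n) (Fin n) ℝ) (hS : Sᵀ = S)
    (C : Matrix (Fin c) (Fin n) ℝ) (hK : IsUnit (Kmat S C))
    (Φ : Matrix (Fin n) (Fin q) ℝ) (R_c : Matrix (Fin c) (Fin q) ℝ) (hCΦ : C * Φ = R_c) :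
    Sc S C Φ = (Psi S C Φ)ᵀ * S * Psi S C Φ := by
  have hD := SDelta_mul_mul_SDelta hK
  rw [Sc_eq hS, Psi, transpose_mul, transpose_sub, transpose_mul, transpose_one, hS,
    transpose_SDelta hS]
  have h : (1 - S * SDelta S C) * S * (1 - SDelta S C * S) = S - S * SDelta S C * S := by
    calc (1 - S * SDelta S C) * S * (1 - SDelta S C * S)
        = S - 2 • (S * SDelta S C * S) + S * (SDelta S C * S * SDelta S C) * S := by
          noncomm_ring
      _ = S - S * SDelta S C * S := by rw [hD]; abel
  rw [← h]
  simp only [Matrix.mul_assoc]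
end

section
/- The coarse basis functions Ψ = (I − S_Δinv*S)*Φ solve the energy-minimization saddle-point problem: there exists a c×p matrix Λ such that S*Ψ + Cᵀ*Λ = 0 and C*Ψ = R_c, i.e., K*[Ψ; Λ] = [0; R_c] (equation (eq:energy-minimization) of the paper). -/
open Matrix

/-- The first block column of `K * K⁻¹ = 1`. -/
theorem Kmat_mul_inv_blocks {n c : ℕ} {S : Matrix (Fin n) (Fin n) ℝ}
    {C : Matrix (Fin c) (Fin n) ℝ} (hK : IsUnit (Kmat S C)) :
    S * SDelta S C + Cᵀ * ((Kmat S C)⁻¹).toBlocks₂₁ = 1 ∧ C * SDelta S C = 0 := by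
  have h := mul_nonsing_inv (Kmat S C) ((isUnit_iff_isUnit_det _).mp hK)
  rw [← fromBlocks_toBlocks (Kmat S C)⁻¹] at h
  nth_rewrite 1 [Kmat] at h
  rw [fromBlocks_multiply, ← fromBlocks_one, fromBlocks_inj] at h
  exact ⟨h.1, by simpa [SDelta] using h.2.2.1⟩

theorem stmt_16 {n c q : ℕ} (hn : 0 < n) (hc : 0 < c) (hq : 0 < q)
    (S : Matrix (Fin n) (Fin n) ℝ) (hS : Sᵀ = S)
    (C : Matrix (Fin c) (Fin n) ℝ) (hK : IsUnit (Kmat S C))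
    (Φ : Matrix (Fin n) (Fin q) ℝ) (R_c : Matrix (Fin c) (Fin q) ℝ) (hCΦ : C * Φ = R_c) :
    ∃ Λ : Matrix (Fin c) (Fin q) ℝ,
      S * Psi S C Φ + Cᵀ * Λ = 0 ∧ C * Psi S C Φ = R_c ∧
      Kmat S C * fromRows (Psi S C Φ) Λ =
        fromRows (0 : Matrix (Fin n) (Fin q) ℝ) R_c := by
  obtain ⟨h₁, h₂⟩ := Kmat_mul_inv_blocks hK
  have hS' : S * Psi S C Φ + Cᵀ * (-(((Kmat S C)⁻¹).toBlocks₂₁ * (S * Φ))) = 0 := by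
    calc _ = S * Φ - (S * SDelta S C + Cᵀ * ((Kmat S C)⁻¹).toBlocks₂₁) * (S * Φ) := by
          simp only [Psi, Matrix.sub_mul, Matrix.mul_sub, Matrix.add_mul, Matrix.one_mul,
            Matrix.mul_neg, Matrix.mul_assoc]
          abel
      _ = 0 := by rw [h₁, Matrix.one_mul, sub_self]
  have hC' : C * Psi S C Φ = R_c := by
    rw [Psi, Matrix.sub_mul, Matrix.one_mul, Matrix.mul_sub, Matrix.mul_assoc,
      ← Matrix.mul_assoc C, h₂, Matrix.zero_mul, sub_zero, hCΦ]
  refine ⟨_, hS', hC', ?_⟩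
  nth_rewrite 1 [Kmat]
  rw [fromBlocks_mul_fromRows, hS', hC', Matrix.zero_mul, add_zero]
end
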